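/- arXiv:1103.2321 — 5 statements merged into one kernel-verified Lean document; each statement's English description precedes it below -/
import Mathlib

section
/- Let α, β ∈ ℂ with α ≠ β, set a = −αβ and b = α + β, and define C(θ) = (α·e^{βθ} − β·e^{αθ})/(α − β) and S(θ) = (e^{αθ} − e^{βθ})/(α − β). Then for all θ₁, θ₂ ∈ ℂ the addition formulae hold: C(θ₁ + θ₂) = C(θ₁)·C(θ₂) + a·S(θ₁)·S(θ₂) and S(θ₁ + θ₂) = S(θ₁)·C(θ₂) + C(θ₁)·S(θ₂) + b·S(θ₁)·S(θ₂). -/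
open Complex

theorem stmt_2 (α β : ℂ) (hαβ : α ≠ β)
    (a b : ℂ) (ha : a = -(α * β)) (hb : b = α + β)
    (C S : ℂ → ℂ)
    (hC : ∀ θ, C θ = (α * exp (β * θ) - β * exp (α * θ)) / (α - β))
    (hS : ∀ θ, S θ = (exp (α * θ) - exp (β * θ)) / (α - β)) :
    ∀ θ₁ θ₂ : ℂ,
      C (θ₁ + θ₂) = C θ₁ * C θ₂ + a * S θ₁ * S θ₂ ∧
      S (θ₁ + θ₂) = S θ₁ * C θ₂ + C θ₁ * S θ₂ + b * S θ₁ * S θ₂ := by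
  intro θ₁ θ₂
  have hsub : α - β ≠ 0 := sub_ne_zero.mpr hαβ
  subst ha hb
  simp only [hC, hS, mul_add, exp_add]
  constructor <;> field_simp <;> ring
end

section
/- Let α, β ∈ ℂ with α ≠ β, and define C(θ) = (α·e^{βθ} − β·e^{αθ})/(α − β) and S(θ) = (e^{αθ} − e^{βθ})/(α − β). Then for every θ ∈ ℂ the fundamental identity e^{(α+β)θ} = C(θ)² + (α + β)·C(θ)·S(θ) + (αβ)·S(θ)² holds. Equivalently, for a 2×2 matrix m̂ with distinct eigenvalues α, β, one has exp(θ·tr m̂) = C(θ)² + (tr m̂)·C(θ)·S(θ) + (det m̂)·S(θ)². -/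
open Complex

theorem stmt_7 (α β : ℂ) (hαβ : α ≠ β)
    (C S : ℂ → ℂ)
    (hC : ∀ θ, C θ = (α * exp (β * θ) - β * exp (α * θ)) / (α - β))
    (hS : ∀ θ, S θ = (exp (α * θ) - exp (β * θ)) / (α - β)) :
    ∀ θ : ℂ,
      exp ((α + β) * θ) =
        C θ ^ 2 + (α + β) * C θ * S θ + (α * β) * S θ ^ 2 := by
  intro θ
  have h : α - β ≠ 0 := sub_ne_zero.mpr hαβ
  have hα : exp (α * θ) = C θ + α * S θ := by
    rw [hC, hS]
    field_simp
    ring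
  have hβ : exp (β * θ) = C θ + β * S θ := by
    rw [hC, hS]
    field_simp
    ring
  rw [add_mul, exp_add, hα, hβ]
  ring
end

section
/- Let α, β ∈ ℝ with α ≠ β, let t = α + β and d = αβ, and define C(θ) = (α·e^{βθ} − β·e^{αθ})/(α − β), S(θ) = (e^{αθ} − e^{βθ})/(α − β), x(θ) = e^{−tθ/2}·C(θ), and y(θ) = e^{−tθ/2}·S(θ). Then for every θ ∈ ℝ the point (x(θ), y(θ)) lies on the conic x² + t·x·y + d·y² = 1. -/
theorem stmt_8 (α β : ℝ) (hαβ : α ≠ β)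
    (t d : ℝ) (ht : t = α + β) (hd : d = α * β)
    (C S x y : ℝ → ℝ)
    (hC : ∀ θ, C θ = (α * Real.exp (β * θ) - β * Real.exp (α * θ)) / (α - β))
    (hS : ∀ θ, S θ = (Real.exp (α * θ) - Real.exp (β * θ)) / (α - β))
    (hx : ∀ θ, x θ = Real.exp (-(t * θ) / 2) * C θ)
    (hy : ∀ θ, y θ = Real.exp (-(t * θ) / 2) * S θ) :
    ∀ θ : ℝ, x θ ^ 2 + t * x θ * y θ + d * y θ ^ 2 = 1 := by
  intro θ
  have hne : α - β ≠ 0 := sub_ne_zero.mpr hαβ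
  have hα : C θ + α * S θ = Real.exp (α * θ) := by
    rw [hC, hS]
    field_simp
    ring
  have hβ : C θ + β * S θ = Real.exp (β * θ) := by
    rw [hC, hS]
    field_simp
    ring
  calc x θ ^ 2 + t * x θ * y θ + d * y θ ^ 2
      = Real.exp (-(t * θ) / 2) ^ 2 * ((C θ + α * S θ) * (C θ + β * S θ)) := by
        rw [hx, hy, hd, ht]
        ring
    _ = 1 := by
        rw [hα, hβ, sq, ← Real.exp_add, ← Real.exp_add, ← Real.exp_add, Real.exp_eq_one_iff, ht]
        ring
end

section
/- Let a₀, a₁, a₂ ∈ ℂ, suppose the cubic λ³ = a₀ + a₁λ + a₂λ² has three pairwise distinct roots η₁, η₂, η₃, and let A₀, A₁, A₂ be defined by (A₀(θ), A₁(θ), A₂(θ))ᵀ = V̂⁻¹·(e^{η₁θ}, e^{η₂θ}, e^{η₃θ})ᵀ, where V̂ is the Vandermonde matrix with rows (1, ηⱼ, ηⱼ²). Then for every θ ∈ ℂ, the determinant of the 3×3 matrix with rows (A₀, a₀A₂, a₀A₁ + a₀a₂A₂), (A₁, A₀ + a₁A₂, a₁A₁ + (a₀ + a₁a₂)A₂),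 (A₂, A₁ + a₂A₂, A₀ + a₂A₁ + (a₁ + a₂²)A₂) (all evaluated at θ) equals e^{a₂θ}. -/
open Complex Matrix

/-- Three distinct roots of the cubic `x ^ 3 = a₀ + a₁ * x + a₂ * x ^ 2` sum to `a₂`. -/
theorem sum_roots_of_cubic {K : Type*} [Field K] {a₀ a₁ a₂ x y z : K}
    (hx : x ^ 3 = a₀ + a₁ * x + a₂ * x ^ 2) (hy : y ^ 3 = a₀ + a₁ * y + a₂ * y ^ 2)
    (hz : z ^ 3 = a₀ + a₁ * z + a₂ * z ^ 2) (hxy : x ≠ y) (hxz : x ≠ z) (hyz : y ≠ z) :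
    x + y + z = a₂ := by
  have hxy' : x ^ 2 + x * y + y ^ 2 = a₁ + a₂ * (x + y) :=
    mul_left_cancel₀ (sub_ne_zero.2 hxy) (by linear_combination hx - hy)
  have hxz' : x ^ 2 + x * z + z ^ 2 = a₁ + a₂ * (x + z) :=
    mul_left_cancel₀ (sub_ne_zero.2 hxz) (by linear_combination hx - hz)
  exact mul_left_cancel₀ (sub_ne_zero.2 hyz) (by linear_combination hxy' - hxz')

theorem stmt_10 (a₀ a₁ a₂ : ℂ) (η : Fin 3 → ℂ)
    (hroots : ∀ j, η j ^ 3 = a₀ + a₁ * η j + a₂ * η j ^ 2)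
    (hdist : Function.Injective η)
    (A : ℂ → Fin 3 → ℂ)
    (hA : ∀ θ, A θ = (Matrix.vandermonde η)⁻¹ *ᵥ fun j => exp (η j * θ)) :
    ∀ θ : ℂ,
      (!![A θ 0, a₀ * A θ 2, a₀ * A θ 1 + a₀ * a₂ * A θ 2;
          A θ 1, A θ 0 + a₁ * A θ 2, a₁ * A θ 1 + (a₀ + a₁ * a₂) * A θ 2;
          A θ 2, A θ 1 + a₂ * A θ 2, A θ 0 + a₂ * A θ 1 + (a₁ + a₂ ^ 2) * A θ 2] :
        Matrix (Fin 3) (Fin 3) ℂ).det = exp (a₂ * θ) := by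
  intro θ
  have hV : (vandermonde η).det ≠ 0 := det_vandermonde_ne_zero_iff.2 hdist
  have hVA : vandermonde η *ᵥ A θ = fun j => exp (η j * θ) := by
    rw [hA, mulVec_mulVec, mul_nonsing_inv _ hV.isUnit, one_mulVec]
  have hE (j : Fin 3) : A θ 0 + η j * A θ 1 + η j ^ 2 * A θ 2 = exp (η j * θ) := by
    simpa [mulVec, dotProduct, Fin.sum_univ_three, vandermonde_apply] using congrFun hVA j
  have hsum : η 0 + η 1 + η 2 = a₂ :=
    sum_roots_of_cubic (hroots 0) (hroots 1) (hroots 2) (hdist.ne (by decide))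
      (hdist.ne (by decide)) (hdist.ne (by decide))
  have hmul : vandermonde η *
      !![A θ 0, a₀ * A θ 2, a₀ * A θ 1 + a₀ * a₂ * A θ 2;
          A θ 1, A θ 0 + a₁ * A θ 2, a₁ * A θ 1 + (a₀ + a₁ * a₂) * A θ 2;
          A θ 2, A θ 1 + a₂ * A θ 2, A θ 0 + a₂ * A θ 1 + (a₁ + a₂ ^ 2) * A θ 2] =
      diagonal (fun j => exp (η j * θ)) * vandermonde η := by
    ext j k
    rw [diagonal_mul, ← hE j]
    have h := hroots j
    fin_cases k <;> simp [mul_apply, Fin.sum_univ_three, vandermonde_apply]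
    · linear_combination (-A θ 2) * h
    · linear_combination (-A θ 1 - (η j + a₂) * A θ 2) * h
  have hdet := congrArg det hmul
  rw [det_mul, det_mul, det_diagonal, mul_comm] at hdet
  rw [mul_right_cancel₀ hV hdet, Fin.prod_univ_three, ← exp_add, ← exp_add, ← hsum]
  ring_nf
end

section
/- Let a, b ∈ ℝ and let u, v : ℝ² → ℝ be twice continuously differentiable functions satisfying the generalized Cauchy–Riemann conditions ∂u/∂y = a·(∂v/∂x) and ∂v/∂y = ∂u/∂x + b·(∂v/∂x) at every point of ℝ². Then both u and v satisfy the second-order partial differential equation ∂²w/∂y² − a·(∂²w/∂x²) − b·(∂²w/∂x∂y) = 0, i.e., they are generalized harmonic functions. -/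
/-- Partial derivative with respect to the first coordinate. -/
noncomputable def pdx (f : ℝ × ℝ → ℝ) : ℝ × ℝ → ℝ := fun p => fderiv ℝ f p (1, 0)

/-- Partial derivative with respect to the second coordinate. -/
noncomputable def pdy (f : ℝ × ℝ → ℝ) : ℝ × ℝ → ℝ := fun p => fderiv ℝ f p (0, 1)

theorem differentiable_pdx {f : ℝ × ℝ → ℝ} (hf : ContDiff ℝ 2 f) : Differentiable ℝ (pdx f) :=
  ((hf.fderiv_right (m := 1) (by norm_num)).clm_apply contDiff_const).differentiable (by norm_num)

theorem pdx_const_mul {f : ℝ × ℝ → ℝ} (hf : Differentiable ℝ f) (c : ℝ) (p : ℝ × ℝ) :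
    pdx (fun q => c * f q) p = c * pdx f p := by
  simp [pdx, fderiv_const_mul (hf p)]

theorem pdy_const_mul {f : ℝ × ℝ → ℝ} (hf : Differentiable ℝ f) (c : ℝ) (p : ℝ × ℝ) :
    pdy (fun q => c * f q) p = c * pdy f p := by
  simp [pdy, fderiv_const_mul (hf p)]

theorem pdx_add {f g : ℝ × ℝ → ℝ} (hf : Differentiable ℝ f) (hg : Differentiable ℝ g)
    (p : ℝ × ℝ) : pdx (fun q => f q + g q) p = pdx f p + pdx g p := by
  simp [pdx, fderiv_fun_add (hf p) (hg p)]

theorem pdy_add {f g : ℝ × ℝ → ℝ} (hf : Differentiable ℝ f) (hg : Differentiable ℝ g)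
    (p : ℝ × ℝ) : pdy (fun q => f q + g q) p = pdy f p + pdy g p := by
  simp [pdy, fderiv_fun_add (hf p) (hg p)]

/-- Mixed second partial derivatives of a `C²` function commute. -/
theorem pdy_pdx_comm {f : ℝ × ℝ → ℝ} (hf : ContDiff ℝ 2 f) (p : ℝ × ℝ) :
    pdy (pdx f) p = pdx (pdy f) p := by
  have hd : DifferentiableAt ℝ (fderiv ℝ f) p :=
    (hf.fderiv_right (m := 1) (by norm_num)).differentiable (by norm_num) p
  have hs : IsSymmSndFDerivAt ℝ f p :=
    hf.contDiffAt.isSymmSndFDerivAt (by simp)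
  have key (v w : ℝ × ℝ) :
      fderiv ℝ (fun q => fderiv ℝ f q v) p w = fderiv ℝ (fderiv ℝ f) p w v := by
    simp [fderiv_clm_apply hd (differentiableAt_const v)]
  exact (key _ _).trans ((hs _ _).trans (key _ _).symm)

theorem stmt_19 (a b : ℝ) (u v : ℝ × ℝ → ℝ)
    (hu : ContDiff ℝ 2 u) (hv : ContDiff ℝ 2 v)
    (hCR1 : ∀ p : ℝ × ℝ, pdy u p = a * pdx v p)
    (hCR2 : ∀ p : ℝ × ℝ, pdy v p = pdx u p + b * pdx v p) :
    (∀ p : ℝ × ℝ, pdy (pdy u) p - a * pdx (pdx u) p - b * pdx (pdy u) p = 0) ∧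
    (∀ p : ℝ × ℝ, pdy (pdy v) p - a * pdx (pdx v) p - b * pdx (pdy v) p = 0) := by
  have hux := differentiable_pdx hu
  have hvx := differentiable_pdx hv
  have eu : pdy u = fun q => a * pdx v q := funext hCR1
  have ev : pdy v = fun q => pdx u q + b * pdx v q := funext hCR2
  have hxu (p : ℝ × ℝ) : pdx (pdy u) p = a * pdx (pdx v) p := by
    rw [eu, pdx_const_mul hvx]
  have hyu (p : ℝ × ℝ) : pdy (pdy u) p = a * pdx (pdy v) p := by
    rw [eu, pdy_const_mul hvx, pdy_pdx_comm hv]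
  have hxv (p : ℝ × ℝ) : pdx (pdy v) p = pdx (pdx u) p + b * pdx (pdx v) p := by
    rw [ev, pdx_add hux (hvx.const_mul b), pdx_const_mul hvx]
  have hyv (p : ℝ × ℝ) : pdy (pdy v) p = pdx (pdy u) p + b * pdx (pdy v) p := by
    conv_lhs => rw [ev]
    rw [pdy_add hux (hvx.const_mul b), pdy_const_mul hvx, pdy_pdx_comm hu, pdy_pdx_comm hv]
  refine ⟨fun p => ?_, fun p => ?_⟩
  · rw [hyu, hxu, hxv]
    ring
  · rw [hyv, hxu]
    ring
end
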